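/- (Compensated shift; finite-configuration version of Definition 4.5 and the preceding remark.) Let ζ be a d-kernel, φ a self-excitation d-kernel and μ measurable baselines. Let (x₁,…,x_p) be points ordered by time satisfying the compatibility condition, and let ω be any finite configuration whose times are distinct from t₁,…,t_p. Define the shifted baseline μ̃^i(t) := μ^i(t) + Σ_{j=1}^{p} φ^{i,k_j}(t − t_j, y_j), and let λ̃ and Z̃ denote the intensity and MSPD functionals built from (ζ, μ̃, φ). Then for every i ∈ {1,…,d} and every t ≥ 0: λ^i_t(ω ∪ {x₁,…,x_p}) = λ̃^i_t(ω); and for every T ≥ 0 with t_j ≤ T for all j: Z^i_T(ω ∪ {x₁,…,x_p}) = Σ_{j=1}^{p} ζ^{i,k_j}(T − t_j, y_j) + Z̃^i_T(ω). -/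

import Mathlib

open MeasureTheory Finset Filter

noncomputable section
namespace MSPD

/-- A marked point `(k, t, θ, y)` of `{1,…,d} × ℝ₊³`. -/
abbrev Point (d : ℕ) := Fin d × ℝ × ℝ × ℝ

variable {d : ℕ}

/-- Auxiliary intensity functional, with fuel `n`. -/
def lamAux (φ : Fin d → Fin d → ℝ → ℝ → ℝ) (μ : Fin d → ℝ → ℝ) :
    ℕ → Finset (Point d) → Fin d → ℝ → ℝ
  | 0, _, i, t => μ i t
  | n + 1, ϖ, i, t => μ i t + ∑ x ∈ ϖ.filter (fun x => x.2.1 < t),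
      φ i x.1 (t - x.2.1) x.2.2.2 * (if x.2.2.1 ≤ lamAux φ μ n ϖ x.1 x.2.1 then 1 else 0)

/-- The intensity functional `λ^i_t(ϖ)`, defined by recursion on the time order of
the points of the finite configuration `ϖ`. -/
def lam (φ : Fin d → Fin d → ℝ → ℝ → ℝ) (μ : Fin d → ℝ → ℝ)
    (ϖ : Finset (Point d)) (i : Fin d) (t : ℝ) : ℝ :=
  lamAux φ μ ϖ.card ϖ i t

/-- The MSPD functional `Z^i_T(ϖ)`. -/
def Zfun (ζ φ : Fin d → Fin d → ℝ → ℝ → ℝ) (μ : Fin d → ℝ → ℝ)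
    (T : ℝ) (i : Fin d) (ϖ : Finset (Point d)) : ℝ :=
  ∑ x ∈ ϖ.filter (fun x => x.2.1 ≤ T),
    ζ i x.1 (T - x.2.1) x.2.2.2 * (if x.2.2.1 ≤ lam φ μ ϖ x.1 x.2.1 then 1 else 0)

/-- The iterated difference operator `𝒯ⁿ_{(x₁,…,xₙ)} F`. -/
def Tdiff (n : ℕ) (xs : Fin n → Point d) (F : Finset (Point d) → ℝ) : ℝ :=
  ∑ J : Finset (Fin n), (-1 : ℝ) ^ (n - J.card) * F (J.image xs)

/-- `ζ` is a d-kernel with respect to the family of mark laws `ν`. -/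
def IsKernel (ν : Fin d → Measure ℝ) (ζ : Fin d → Fin d → ℝ → ℝ → ℝ) : Prop :=
  (∀ i k, Measurable fun p : ℝ × ℝ => ζ i k p.1 p.2) ∧
    (∀ i k t y, 0 ≤ ζ i k t y) ∧ ∀ i k t, Integrable (fun y => ζ i k t y) (ν k)

/-- `φ` is a self-excitation d-kernel: a d-kernel vanishing for nonpositive times. -/
def IsSelfExciting (ν : Fin d → Measure ℝ) (φ : Fin d → Fin d → ℝ → ℝ → ℝ) : Prop :=
  IsKernel ν φ ∧ ∀ i k τ y, τ ≤ 0 → φ i k τ y = 0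

/-- `μ` is a family of measurable nonnegative baselines. -/
def IsBaseline (μ : Fin d → ℝ → ℝ) : Prop :=
  (∀ i, Measurable (μ i)) ∧ ∀ i t, 0 ≤ μ i t

/-- The compatibility condition for a time-ordered tuple of points. -/
def Compatible (φ : Fin d → Fin d → ℝ → ℝ → ℝ) (μ : Fin d → ℝ → ℝ)
    {n : ℕ} (xs : Fin n → Point d) : Prop :=
  ∀ m : Fin n, (xs m).2.2.1 ≤ μ (xs m).1 (xs m).2.1 +
    ∑ j ∈ Finset.Iio m, φ (xs m).1 (xs j).1 ((xs m).2.1 - (xs j).2.1) (xs j).2.2.2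

end MSPD
end

open MSPD MeasureTheory Finset

namespace MSPD

variable {d : ℕ}

theorem lamAux_eq_of_card_le (φ : Fin d → Fin d → ℝ → ℝ → ℝ) (μ : Fin d → ℝ → ℝ)
    (ϖ : Finset (Point d)) (n m : ℕ) (i : Fin d) (t : ℝ)
    (hn : (ϖ.filter fun x => x.2.1 < t).card ≤ n)
    (hm : (ϖ.filter fun x => x.2.1 < t).card ≤ m) :
    lamAux φ μ n ϖ i t = lamAux φ μ m ϖ i t := by
  induction n generalizing m i t with
  | zero =>
    have h : ϖ.filter (fun x => x.2.1 < t) = ∅ := card_eq_zero.mp (Nat.le_zero.mp hn)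
    cases m <;> simp [lamAux, h]
  | succ n ih =>
    cases m with
    | zero =>
      have h : ϖ.filter (fun x => x.2.1 < t) = ∅ := card_eq_zero.mp (Nat.le_zero.mp hm)
      simp [lamAux, h]
    | succ m =>
      simp only [lamAux]
      congr 1
      refine sum_congr rfl fun x hx => ?_
      have hlt : (ϖ.filter fun z => z.2.1 < x.2.1).card
          < (ϖ.filter fun z => z.2.1 < t).card := by
        have hxt := (mem_filter.mp hx).2
        refine card_lt_card ((ssubset_iff_of_subset ?_).mpr ⟨x, hx, by simp⟩)
        exact monotone_filter_right ϖ fun z _ hz => lt_trans hz hxt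
      rw [ih m x.1 x.2.1 (by omega) (by omega)]

/-- The recursion defining the intensity functional, without fuel. -/
theorem lam_eq (φ : Fin d → Fin d → ℝ → ℝ → ℝ) (μ : Fin d → ℝ → ℝ)
    (ϖ : Finset (Point d)) (i : Fin d) (t : ℝ) :
    lam φ μ ϖ i t = μ i t + ∑ x ∈ ϖ.filter (fun x => x.2.1 < t),
      φ i x.1 (t - x.2.1) x.2.2.2 * (if x.2.2.1 ≤ lam φ μ ϖ x.1 x.2.1 then 1 else 0) := by
  rw [lam, lamAux_eq_of_card_le φ μ ϖ ϖ.card (ϖ.card + 1) i t (card_filter_le _ _)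
    ((card_filter_le _ _).trans (Nat.le_succ _))]
  rfl

theorem baseline_le_lam {φ : Fin d → Fin d → ℝ → ℝ → ℝ} (hφ : ∀ i k t y, 0 ≤ φ i k t y)
    (μ : Fin d → ℝ → ℝ) (ϖ : Finset (Point d)) (i : Fin d) (t : ℝ) :
    μ i t ≤ lam φ μ ϖ i t := by
  rw [lam_eq]
  refine le_add_of_nonneg_right (sum_nonneg fun x _ => mul_nonneg (hφ _ _ _ _) ?_)
  split_ifs <;> norm_num

/-- Compatible points are accepted by the intensity with the shifted baseline. -/
theorem Compatible.le_lam_shift {φ : Fin d → Fin d → ℝ → ℝ → ℝ} {μ : Fin d → ℝ → ℝ}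
    {p : ℕ} {xs : Fin p → Point d} (hcomp : Compatible φ μ xs)
    (hφ : ∀ i k t y, 0 ≤ φ i k t y) (ω : Finset (Point d)) (j : Fin p) :
    (xs j).2.2.1 ≤ lam φ (fun i' t' => μ i' t' +
      ∑ j : Fin p, φ i' (xs j).1 (t' - (xs j).2.1) (xs j).2.2.2) ω (xs j).1 (xs j).2.1 := by
  refine le_trans ?_ (baseline_le_lam hφ _ ω _ _)
  refine (hcomp j).trans (add_le_add le_rfl ?_)
  exact sum_le_sum_of_subset_of_nonneg (subset_univ _) fun _ _ _ => hφ _ _ _ _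

/-- A sum over the points of `ω ∪ {x₁,…,xₚ}` satisfying `P` splits when the `xⱼ` are distinct and
do not belong to `ω`. -/
theorem sum_filter_union_image {p : ℕ} {xs : Fin p → Point d} (hinj : Function.Injective xs)
    {ω : Finset (Point d)} (hdisj : ∀ j, xs j ∉ ω) (P : Point d → Prop) [DecidablePred P]
    (f : Point d → ℝ) :
    ∑ x ∈ (ω ∪ univ.image xs).filter P, f x
      = ∑ x ∈ ω.filter P, f x + ∑ j, if P (xs j) then f (xs j) else 0 := by
  have hd : Disjoint ω (univ.image xs) := by
    rw [disjoint_right]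
    simpa using hdisj
  rw [sum_filter, sum_union hd, sum_image hinj.injOn, sum_filter]

/-- The compensated shift for the intensity functional. -/
theorem lam_union_image_eq {φ : Fin d → Fin d → ℝ → ℝ → ℝ} {μ : Fin d → ℝ → ℝ}
    (hφ : ∀ i k t y, 0 ≤ φ i k t y) (hφ0 : ∀ i k τ y, τ ≤ 0 → φ i k τ y = 0)
    {p : ℕ} {xs : Fin p → Point d} (hinj : Function.Injective xs) (hcomp : Compatible φ μ xs)
    {ω : Finset (Point d)} (hdisj : ∀ j, xs j ∉ ω) (i : Fin d) (t : ℝ) :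
    lam φ μ (ω ∪ univ.image xs) i t =
      lam φ (fun i' t' => μ i' t' +
        ∑ j : Fin p, φ i' (xs j).1 (t' - (xs j).2.1) (xs j).2.2.2) ω i t := by
  induction hn : ((ω ∪ univ.image xs).filter fun x => x.2.1 < t).card
    using Nat.strong_induction_on generalizing i t with
  | _ n ih =>
  have key : ∀ x ∈ ω ∪ univ.image xs, x.2.1 < t → ∀ k,
      lam φ μ (ω ∪ univ.image xs) k x.2.1 = lam φ (fun i' t' => μ i' t' +
        ∑ j : Fin p, φ i' (xs j).1 (t' - (xs j).2.1) (xs j).2.2.2) ω k x.2.1 := by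
    intro x hx hxt k
    refine ih _ ?_ k x.2.1 rfl
    rw [← hn]
    refine card_lt_card ((ssubset_iff_of_subset ?_).mpr
      ⟨x, mem_filter.mpr ⟨hx, hxt⟩, by simp⟩)
    exact monotone_filter_right _ fun z _ hz => lt_trans hz hxt
  rw [lam_eq, lam_eq, sum_filter_union_image hinj hdisj, add_assoc, add_comm (∑ x ∈ _, _)]
  congr 2
  · refine sum_congr rfl fun j _ => ?_
    split_ifs with hjt hle
    · rw [mul_one]
    · refine absurd ?_ hle
      rw [key (xs j) (by simp) hjt]
      exact hcomp.le_lam_shift hφ ω j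
    · exact (hφ0 _ _ _ _ (by linarith)).symm
  · refine sum_congr rfl fun x hx => ?_
    rw [mem_filter] at hx
    rw [key x (mem_union_left _ hx.1) hx.2]

end MSPD

/-- compensated shift: for time-ordered compatible points
`x₁,…,xₚ` and a finite configuration `ω` with times distinct from the `tⱼ`, the shifted
intensity coincides with the intensity built from the shifted baseline
`μ̃^i(t) = μ^i(t) + Σⱼ φ^{i,kⱼ}(t−tⱼ,yⱼ)`, and similarly for the MSPD functional. -/
theorem statement12 (d : ℕ) (hd : 1 ≤ d)
    (ν : Fin d → Measure ℝ) [∀ k, IsProbabilityMeasure (ν k)]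
    (hν : ∀ k, ν k (Set.Iio 0) = 0)
    (ζ φ : Fin d → Fin d → ℝ → ℝ → ℝ) (μ : Fin d → ℝ → ℝ)
    (hζ : IsKernel ν ζ) (hφ : IsSelfExciting ν φ) (hμ : IsBaseline μ)
    (p : ℕ) (xs : Fin p → Point d)
    (hmono : StrictMono fun j => (xs j).2.1)
    (hts : ∀ j, 0 < (xs j).2.1)
    (hθ : ∀ j, 0 ≤ (xs j).2.2.1) (hy : ∀ j, 0 ≤ (xs j).2.2.2)
    (hcomp : Compatible φ μ xs)
    (ω : Finset (Point d))
    (hωdist : ∀ x ∈ ω, ∀ x' ∈ ω, x.2.1 = x'.2.1 → x = x')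
    (hωpos : ∀ x ∈ ω, 0 ≤ x.2.1 ∧ 0 ≤ x.2.2.1 ∧ 0 ≤ x.2.2.2)
    (hdisj : ∀ x ∈ ω, ∀ j, x.2.1 ≠ (xs j).2.1) :
    (∀ (i : Fin d) (t : ℝ), 0 ≤ t →
        lam φ μ (ω ∪ Finset.image xs Finset.univ) i t =
          lam φ (fun i' t' => μ i' t' +
              ∑ j : Fin p, φ i' (xs j).1 (t' - (xs j).2.1) (xs j).2.2.2) ω i t) ∧
    (∀ (i : Fin d) (T : ℝ), 0 ≤ T → (∀ j, (xs j).2.1 ≤ T) →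
        Zfun ζ φ μ T i (ω ∪ Finset.image xs Finset.univ) =
          (∑ j : Fin p, ζ i (xs j).1 (T - (xs j).2.1) (xs j).2.2.2) +
            Zfun ζ φ (fun i' t' => μ i' t' +
              ∑ j : Fin p, φ i' (xs j).1 (t' - (xs j).2.1) (xs j).2.2.2) T i ω) := by
  have hinj : Function.Injective xs := fun a b h =>
    hmono.injective (congrArg (fun x : Point d => x.2.1) h)
  have hnot : ∀ j, xs j ∉ ω := fun j hj => hdisj _ hj j rfl
  have hlam := lam_union_image_eq hφ.1.2.1 hφ.2 hinj hcomp hnot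
  refine ⟨fun i t _ => hlam i t, fun i T _ hT => ?_⟩
  simp only [Zfun, hlam]
  rw [sum_filter_union_image hinj hnot, add_comm]
  congr 1
  refine sum_congr rfl fun j _ => ?_
  rw [if_pos (hT j), if_pos (hcomp.le_lam_shift hφ.1.2.1 ω j), mul_one]
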